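/- Let γ ⊂ ℙ² be an irreducible conic and let ℓ₁,ℓ₂,ℓ₃, m₁,m₂,m₃, n₁,n₂,n₃ be nine pairwise distinct lines tangent to γ, defining the contact star configurations X₁ = 𝕊(ℓ₁,ℓ₂,ℓ₃), X₂ = 𝕊(m₁,m₂,m₃), X₃ = 𝕊(n₁,n₂,n₃) on γ. For each pair 1 ≤ i < j ≤ 3, let q_{ij} be a nonzero homogeneous quadratic form vanishing at every point of X_i ∪ X_j (such forms exist). Then there is a point of ℙ² at which q₁₂, q₁₃ and q₂₃ all vanish; that is, the three conics γ₁₂, γ₁₃, γ₂₃ through the pairwise unions meet in a common point. -/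

import Mathlib

open MvPolynomial

noncomputable section

abbrev P2 : Type := Projectivization ℂ (Fin 3 → ℂ)

/-- A line in `ℙ²`: the zero locus of a nonzero linear form. -/
def IsLine (L : Set P2) : Prop :=
  ∃ a : Fin 3 → ℂ, a ≠ 0 ∧ L = {p : P2 | (∑ i, a i * p.rep i) = 0}

/-- An irreducible conic in `ℙ²`: the zero locus of an irreducible homogeneous quadratic form. -/
def IsIrredConic (γ : Set P2) : Prop :=
  ∃ q : MvPolynomial (Fin 3) ℂ, q.IsHomogeneous 2 ∧ Irreducible q ∧
    γ = {p : P2 | eval p.rep q = 0}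

/-- `L` is tangent to `γ` : their intersection is a single point. -/
def IsTangent (L γ : Set P2) : Prop := ∃ p : P2, L ∩ γ = {p}

/-- The star configuration defined by a family of lines: the set of points lying on at
least two of the lines. -/
def starConfig {r : ℕ} (L : Fin r → Set P2) : Set P2 :=
  {p : P2 | ∃ i j : Fin r, i ≠ j ∧ p ∈ L i ∧ p ∈ L j}

/-- A family of lines meets properly: they are distinct lines, no three concurrent. -/
def MeetsProperly {r : ℕ} (L : Fin r → Set P2) : Prop :=
  (∀ i, IsLine (L i)) ∧ Function.Injective L ∧
    ∀ (p : P2) (i j k : Fin r), p ∈ L i → p ∈ L j → p ∈ L k → i = j ∨ i = k ∨ j = k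

/-- `W` is a complete intersection of type `(a,b)`. -/
def IsCI (W : Set P2) (a b : ℕ) : Prop :=
  ∃ F G : MvPolynomial (Fin 3) ℂ, F ≠ 0 ∧ G ≠ 0 ∧
    F.IsHomogeneous a ∧ G.IsHomogeneous b ∧
    {p : P2 | eval p.rep F = 0 ∧ eval p.rep G = 0} = W ∧ W.ncard = a * b

/-- The `ℂ`-submodule of polynomials vanishing at every point of `W`. -/
def vanishingSubmodule (W : Set P2) : Submodule ℂ (MvPolynomial (Fin 3) ℂ) where
  carrier := {F : MvPolynomial (Fin 3) ℂ | ∀ p ∈ W, eval p.rep F = 0}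
  add_mem' := by
    intro a b ha hb p hp
    simp only [map_add, ha p hp, hb p hp, add_zero]
  zero_mem' := by
    intro p hp
    simp
  smul_mem' := by
    intro c F hF p hp
    simp only [smul_eval, hF p hp, mul_zero]

/-- The degree-`d` graded component of the vanishing ideal of `W`. -/
def idealComp (W : Set P2) (d : ℕ) : Submodule ℂ (MvPolynomial (Fin 3) ℂ) :=
  homogeneousSubmodule (Fin 3) ℂ d ⊓ vanishingSubmodule W

/-- The Hilbert function of `W ⊆ ℙ²`. -/
def HF (W : Set P2) (d : ℕ) : ℤ :=
  (Module.finrank ℂ ↥(homogeneousSubmodule (Fin 3) ℂ d) : ℤ) -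
    (Module.finrank ℂ ↥(idealComp W d) : ℤ)

/-- The h-vector of `W ⊆ ℙ²`. -/
def hvec (W : Set P2) : ℕ → ℤ
  | 0 => HF W 0
  | d + 1 => HF W (d + 1) - HF W d

/-- The (affine cone) ideal of a point of `ℙ²`; its powers cut out fat points. -/
def pointIdeal (p : P2) : Ideal (MvPolynomial (Fin 3) ℂ) := RingHom.ker (eval p.rep)

/-- The degree-`d` graded component of a homogeneous ideal `I`. -/
def idealCompI (I : Ideal (MvPolynomial (Fin 3) ℂ)) (d : ℕ) :
    Submodule ℂ (MvPolynomial (Fin 3) ℂ) :=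
  homogeneousSubmodule (Fin 3) ℂ d ⊓ Submodule.restrictScalars ℂ I

/-- The Hilbert function of `S/I`. -/
def HFI (I : Ideal (MvPolynomial (Fin 3) ℂ)) (d : ℕ) : ℤ :=
  (Module.finrank ℂ ↥(homogeneousSubmodule (Fin 3) ℂ d) : ℤ) -
    (Module.finrank ℂ ↥(idealCompI I d) : ℤ)

/-- The h-vector of `S/I`. -/
def hvecI (I : Ideal (MvPolynomial (Fin 3) ℂ)) : ℕ → ℤ
  | 0 => HFI I 0
  | d + 1 => HFI I (d + 1) - HFI I d

/-- The Hadamard-product relation: `R = P ⋆ Q`. -/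
def hadRel (P Q R : P2) : Prop :=
  ∃ (u v : Fin 3 → ℂ) (hu : u ≠ 0) (hv : v ≠ 0) (huv : (fun i => u i * v i) ≠ 0),
    Projectivization.mk ℂ u hu = P ∧ Projectivization.mk ℂ v hv = Q ∧
      Projectivization.mk ℂ (fun i => u i * v i) huv = R

/-- `Δ₀`: points of `ℙ²` with at most one nonzero coordinate. -/
def Δ₀ : Set P2 := {p : P2 | ∃ i : Fin 3, ∀ j : Fin 3, j ≠ i → p.rep j = 0}


/-- The quadratic map attached to a homogeneous quadratic polynomial. -/
theorem exists_quadraticForm_of_isHomogeneous {σ R : Type*} [Finite σ] [CommRing R]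
    {q : MvPolynomial σ R} (hq : q.IsHomogeneous 2) :
    ∃ Q : QuadraticMap R (σ → R) R, ∀ x, eval x q = Q x := by
  classical
  have key : ∀ d ∈ q.support, ∃ Q : QuadraticMap R (σ → R) R,
      ∀ x, eval x (monomial d (coeff d q)) = Q x := by
    intro d hd
    have hdeg : d.degree = 2 := by
      rw [Finsupp.degree_eq_weight_one]
      exact hq (mem_support_iff.mp hd)
    have hd0 : d ≠ 0 := by
      rintro rfl
      simp at hdeg
    obtain ⟨i, hi⟩ := Finsupp.ne_iff.mp hd0
    have hle : Finsupp.single i 1 ≤ d := by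
      rw [Finsupp.single_le_iff]
      exact Nat.one_le_iff_ne_zero.mpr hi
    obtain ⟨d', rfl⟩ := exists_add_of_le hle
    have hdeg' : d'.degree = 1 := by
      rw [map_add, Finsupp.degree_single] at hdeg
      omega
    have hd0' : d' ≠ 0 := by
      rintro rfl
      simp at hdeg'
    obtain ⟨j, hj⟩ := Finsupp.ne_iff.mp hd0'
    have hle' : Finsupp.single j 1 ≤ d' := by
      rw [Finsupp.single_le_iff]
      exact Nat.one_le_iff_ne_zero.mpr hj
    obtain ⟨e, rfl⟩ := exists_add_of_le hle'
    have he : e = 0 := by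
      rw [← Finsupp.degree_eq_zero_iff]
      rw [map_add, Finsupp.degree_single] at hdeg'
      omega
    subst he
    refine ⟨coeff (Finsupp.single i 1 + (Finsupp.single j 1 + 0)) q • QuadraticMap.proj i j,
      fun x => ?_⟩
    simp [eval_monomial, Finsupp.prod_add_index', pow_add]
  choose! Q hQ using key
  refine ⟨∑ d ∈ q.support, Q d, fun x => ?_⟩
  conv_lhs => rw [q.as_sum]
  rw [map_sum, sum_apply]
  exact Finset.sum_congr rfl fun d hd => hQ d hd x

/-- Vanishing of a homogeneous quadratic polynomial at a projective point may be tested on any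
representative. -/
theorem eval_rep_mk_eq_zero_iff {q : MvPolynomial (Fin 3) ℂ} (hq : q.IsHomogeneous 2)
    {v : Fin 3 → ℂ} (hv : v ≠ 0) :
    eval (Projectivization.mk ℂ v hv).rep q = 0 ↔ eval v q = 0 := by
  obtain ⟨Q, hQ⟩ := exists_quadraticForm_of_isHomogeneous hq
  obtain ⟨a, ha⟩ := Projectivization.exists_smul_eq_mk_rep ℂ v hv
  rw [← ha, Units.smul_def, hQ, hQ, QuadraticMap.map_smul]
  simp

/-- Vanishing of a linear form at a projective point may be tested on any representative. -/
theorem linear_rep_mk_eq_zero_iff (φ : (Fin 3 → ℂ) →ₗ[ℂ] ℂ) {v : Fin 3 → ℂ} (hv : v ≠ 0) :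
    φ (Projectivization.mk ℂ v hv).rep = 0 ↔ φ v = 0 := by
  obtain ⟨a, ha⟩ := Projectivization.exists_smul_eq_mk_rep ℂ v hv
  rw [← ha, Units.smul_def, map_smul]
  simp

theorem LinearMap.apply_eq_sum_mul_single {R ι : Type*} [CommSemiring R] [Fintype ι]
    [DecidableEq ι] (θ : (ι → R) →ₗ[R] R) (x : ι → R) :
    θ x = ∑ i, x i * θ (Pi.single i 1) := by
  conv_lhs => rw [← Finset.univ_sum_single x]
  rw [map_sum]
  refine Finset.sum_congr rfl fun i _ => ?_
  rw [← smul_eq_mul, ← map_smul, ← Pi.single_smul', smul_eq_mul, mul_one]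

/-- An irreducible polynomial is not, as a function, a product of two linear forms. -/
theorem not_irreducible_of_eval_eq_mul {q : MvPolynomial (Fin 3) ℂ}
    (φ ψ : (Fin 3 → ℂ) →ₗ[ℂ] ℂ) (h : ∀ x, eval x q = φ x * ψ x) : ¬ Irreducible q := by
  intro hq
  have hlin : ∀ θ : (Fin 3 → ℂ) →ₗ[ℂ] ℂ, ∃ p : MvPolynomial (Fin 3) ℂ, ∀ x, eval x p = θ x := by
    intro θ
    refine ⟨∑ i, C (θ (Pi.single i 1)) * X i, fun x => ?_⟩
    rw [θ.apply_eq_sum_mul_single x]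
    simp [mul_comm]
  obtain ⟨p, hp⟩ := hlin φ
  obtain ⟨p', hp'⟩ := hlin ψ
  have hnu : ∀ (θ : (Fin 3 → ℂ) →ₗ[ℂ] ℂ) (p : MvPolynomial (Fin 3) ℂ),
      (∀ x, eval x p = θ x) → ¬ IsUnit p := by
    intro θ p hp hu
    have := (hu.map (eval (0 : Fin 3 → ℂ))).ne_zero
    rw [hp, map_zero] at this
    exact this rfl
  have hqp : q = p * p' := MvPolynomial.funext fun x => by rw [h, map_mul, hp, hp']
  rcases hq.isUnit_or_isUnit hqp with hu | hu
  · exact hnu φ p hp hu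
  · exact hnu ψ p' hp' hu

/-- An irreducible quadratic form in three variables over `ℂ` is, in suitable linear
coordinates, the discriminant of a binary quadratic form. -/
theorem exists_equiv_eval_eq_discrim {q : MvPolynomial (Fin 3) ℂ} (hq : q.IsHomogeneous 2)
    (hirr : Irreducible q) :
    ∃ N : (Fin 3 → ℂ) ≃ₗ[ℂ] (Fin 3 → ℂ),
      ∀ x, eval x q = N x 1 ^ 2 - 4 * (N x 0 * N x 2) := by
  obtain ⟨Q, hQ⟩ := exists_quadraticForm_of_isHomogeneous hq
  have hdiag := QuadraticForm.equivalent_weightedSumSquares Q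
  rw [Module.finrank_fin_fun] at hdiag
  obtain ⟨w, ⟨E⟩⟩ := hdiag
  have hE : ∀ x, eval x q = w 0 * E x 0 ^ 2 + w 1 * E x 1 ^ 2 + w 2 * E x 2 ^ 2 := by
    intro x
    rw [hQ, ← E.map_app x, QuadraticMap.weightedSumSquares_apply, Fin.sum_univ_three]
    simp [sq]
  choose r hr' using fun i => IsAlgClosed.exists_pow_nat_eq (w i) two_pos
  have hr : ∀ i, w i = r i ^ 2 := fun i => (hr' i).symm
  have hI := Complex.I_sq
  have hfac : ∀ j k : Fin 3,
      ¬ ∀ x, eval x q = w j * E x j ^ 2 + w k * E x k ^ 2 := by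
    intro j k h
    refine not_irreducible_of_eval_eq_mul
      ((r j • LinearMap.proj j + (Complex.I * r k) • LinearMap.proj k) ∘ₗ E.toLinearMap)
      ((r j • LinearMap.proj j - (Complex.I * r k) • LinearMap.proj k) ∘ₗ E.toLinearMap)
      (fun x => ?_) hirr
    rw [h, hr j, hr k]
    simp
    linear_combination (r k ^ 2 * E x k ^ 2) * hI
  have h0 : r 0 ≠ 0 := fun h => hfac 1 2 fun x => by rw [hE, hr 0, h]; ring
  have h1 : r 1 ≠ 0 := fun h => hfac 0 2 fun x => by rw [hE, hr 1, h]; ring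
  have h2 : r 2 ≠ 0 := fun h => hfac 0 1 fun x => by rw [hE, hr 2, h]; ring
  let z : Fin 3 → (Fin 3 → ℂ) →ₗ[ℂ] ℂ := fun i => r i • (LinearMap.proj i ∘ₗ E.toLinearMap)
  have hz : ∀ i x, z i x = r i * E x i := fun i x => by simp [z]
  let T : (Fin 3 → ℂ) →ₗ[ℂ] (Fin 3 → ℂ) :=
    LinearMap.pi ![(-1 / 2 : ℂ) • (z 1 + Complex.I • z 2), z 0,
      (1 / 2 : ℂ) • (z 1 - Complex.I • z 2)]
  have T0 : ∀ x, T x 0 = -1 / 2 * (r 1 * E x 1 + Complex.I * (r 2 * E x 2)) := fun x => by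
    simp [T, hz]
    ring
  have T1 : ∀ x, T x 1 = r 0 * E x 0 := fun x => by simp [T, hz]
  have T2 : ∀ x, T x 2 = 1 / 2 * (r 1 * E x 1 - Complex.I * (r 2 * E x 2)) := fun x => by
    simp [T, hz]
  have hinj : Function.Injective T := by
    rw [injective_iff_map_eq_zero]
    intro x hx
    have t0 := T0 x
    have t1 := T1 x
    have t2 := T2 x
    rw [hx, Pi.zero_apply] at t0 t1 t2
    have e0 : E x 0 = 0 := by simpa [h0] using t1.symm
    have e1 : E x 1 = 0 := by
      have : r 1 * E x 1 = 0 := by linear_combination t0 - t2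
      simpa [h1] using this
    have e2 : E x 2 = 0 := by
      have : Complex.I * (r 2 * E x 2) = 0 := by linear_combination t0 + t2
      simpa [h2] using this
    have : E.toLinearEquiv x = 0 := by
      ext i
      fin_cases i <;> assumption
    simpa using this
  refine ⟨LinearEquiv.ofInjectiveEndo T hinj, fun x => ?_⟩
  rw [LinearEquiv.coe_ofInjectiveEndo, T0, T1, T2, hE, hr 0, hr 1, hr 2]
  linear_combination (r 2 ^ 2 * E x 2 ^ 2) * hI

/-- The value of the binary quadratic form with coefficients `y` at `t`. -/
def binEval (t : ℂ × ℂ) : (Fin 3 → ℂ) →ₗ[ℂ] ℂ :=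
  t.1 ^ 2 • LinearMap.proj 0 + (t.1 * t.2) • LinearMap.proj 1 + t.2 ^ 2 • LinearMap.proj 2

theorem binEval_apply (t : ℂ × ℂ) (y : Fin 3 → ℂ) :
    binEval t y = t.1 ^ 2 * y 0 + t.1 * t.2 * y 1 + t.2 ^ 2 * y 2 := by
  simp [binEval]

/-- The determinant of two vectors of `ℂ²`. -/
def bracket (s t : ℂ × ℂ) : ℂ := s.1 * t.2 - s.2 * t.1

/-- The coefficients of the binary quadratic form with roots `s` and `t`. -/
def binProd (s t : ℂ × ℂ) : Fin 3 → ℂ := ![s.2 * t.2, -(s.2 * t.1 + s.1 * t.2), s.1 * t.1]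

theorem binEval_binProd (r s t : ℂ × ℂ) :
    binEval r (binProd s t) = bracket r s * bracket r t := by
  simp [binEval_apply, binProd, bracket]
  ring

/-- A binary quadratic form with three distinct roots vanishes. -/
theorem eq_zero_of_binEval_eq_zero {r s t : ℂ × ℂ} (hrs : bracket r s ≠ 0)
    (hrt : bracket r t ≠ 0) (hst : bracket s t ≠ 0) {y : Fin 3 → ℂ}
    (hr : binEval r y = 0) (hs : binEval s y = 0) (ht : binEval t y = 0) : y = 0 := by
  have hne : bracket r s * bracket r t * bracket s t ≠ 0 := by positivity
  rw [binEval_apply] at hr hs ht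
  have h0 : bracket r s * bracket r t * bracket s t * y 0 = 0 := by
    simp only [bracket]
    linear_combination (s.2 * t.2 * (s.1 * t.2 - s.2 * t.1)) * hr
      - (r.2 * t.2 * (r.1 * t.2 - r.2 * t.1)) * hs + (r.2 * s.2 * (r.1 * s.2 - r.2 * s.1)) * ht
  have h1 : bracket r s * bracket r t * bracket s t * y 1 = 0 := by
    simp only [bracket]
    linear_combination (-(s.1 ^ 2 * t.2 ^ 2 - s.2 ^ 2 * t.1 ^ 2)) * hr
      + (r.1 ^ 2 * t.2 ^ 2 - r.2 ^ 2 * t.1 ^ 2) * hs - (r.1 ^ 2 * s.2 ^ 2 - r.2 ^ 2 * s.1 ^ 2) * ht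
  have h2 : bracket r s * bracket r t * bracket s t * y 2 = 0 := by
    simp only [bracket]
    linear_combination (s.1 * t.1 * (s.1 * t.2 - s.2 * t.1)) * hr
      - (r.1 * t.1 * (r.1 * t.2 - r.2 * t.1)) * hs + (r.1 * s.1 * (r.1 * s.2 - r.2 * s.1)) * ht
  ext i
  fin_cases i
  · exact (mul_eq_zero.mp h0).resolve_left hne
  · exact (mul_eq_zero.mp h1).resolve_left hne
  · exact (mul_eq_zero.mp h2).resolve_left hne

theorem bracket_swap (s t : ℂ × ℂ) : bracket s t = -bracket t s := by
  simp only [bracket]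
  ring

theorem bracket_self (s : ℂ × ℂ) : bracket s s = 0 := by
  simp only [bracket]
  ring

/-- Lagrange interpolation of binary quadratic forms. -/
theorem exists_eq_binProd_combination {r s t : ℂ × ℂ} (hrs : bracket r s ≠ 0)
    (hrt : bracket r t ≠ 0) (hst : bracket s t ≠ 0) (y : Fin 3 → ℂ) :
    y = (binEval t y / (bracket t r * bracket t s)) • binProd r s +
      (binEval s y / (bracket s r * bracket s t)) • binProd r t +
      (binEval r y / (bracket r s * bracket r t)) • binProd s t := by
  rw [← sub_eq_zero]
  have hsr : bracket s r ≠ 0 := by rwa [bracket_swap, neg_ne_zero]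
  have htr : bracket t r ≠ 0 := by rwa [bracket_swap, neg_ne_zero]
  have hts : bracket t s ≠ 0 := by rwa [bracket_swap, neg_ne_zero]
  apply eq_zero_of_binEval_eq_zero hrs hrt hst <;>
  · simp only [map_sub, map_add, map_smul, binEval_binProd, bracket_self, smul_eq_mul]
    field_simp
    simp

/-- The coefficients of the binary cubic form with roots `r`, `s` and `t`. -/
def binCubic (r s t : ℂ × ℂ) : Fin 4 → ℂ :=
  ![r.2 * s.2 * t.2, -(r.1 * s.2 * t.2 + r.2 * s.1 * t.2 + r.2 * s.2 * t.1),
    r.1 * s.1 * t.2 + r.1 * s.2 * t.1 + r.2 * s.1 * t.1, -(r.1 * s.1 * t.1)]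

/-- The matrix whose rows are `f`, `g` and the two products of the binary quadratic form `y`
with the coordinates. -/
def bezoutMatrix (f g : Fin 4 → ℂ) (y : Fin 3 → ℂ) : Matrix (Fin 4) (Fin 4) ℂ :=
  !![f 0, f 1, f 2, f 3; g 0, g 1, g 2, g 3; y 0, y 1, y 2, 0; 0, y 0, y 1, y 2]

/-- The Bezoutian of two binary cubic forms, as a quadratic form on the space of binary quadratic
forms: it vanishes at `y` when `f` and `g` are linearly dependent modulo `y`. -/
def bezoutian (f g : Fin 4 → ℂ) : QuadraticForm ℂ (Fin 3 → ℂ) :=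
  (f 0 * g 1 - f 1 * g 0) • QuadraticMap.proj 2 2 - (f 0 * g 2 - f 2 * g 0) • QuadraticMap.proj 1 2
    + (f 0 * g 3 - f 3 * g 0) • (QuadraticMap.proj 1 1 - QuadraticMap.proj 0 2)
    + (f 1 * g 2 - f 2 * g 1) • QuadraticMap.proj 0 2
    - (f 1 * g 3 - f 3 * g 1) • QuadraticMap.proj 0 1
    + (f 2 * g 3 - f 3 * g 2) • QuadraticMap.proj 0 0

theorem bezoutian_apply (f g : Fin 4 → ℂ) (y : Fin 3 → ℂ) :
    bezoutian f g y = (bezoutMatrix f g y).det := by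
  simp [bezoutian, bezoutMatrix, Matrix.det_succ_row_zero, Fin.sum_univ_succ, Fin.succAbove]
  ring

theorem bezoutian_swap (f g : Fin 4 → ℂ) (y : Fin 3 → ℂ) :
    bezoutian f g y = -bezoutian g f y := by
  simp [bezoutian]
  ring

theorem bezoutian_binCubic_binProd (r s t r' s' t' x : ℂ × ℂ) :
    bezoutian (binCubic r s t) (binCubic r' s' t') (binProd r x) =
      bracket r r' * bracket r s' * bracket r t' * bracket x s * bracket x t := by
  simp [bezoutian, binCubic, binProd, bracket]
  ring

theorem bezoutian_binCubic_binProd_eq_zero (a : Fin 3 → ℂ × ℂ) (r' s' t' : ℂ × ℂ) {i j : Fin 3}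
    (hij : i ≠ j) :
    bezoutian (binCubic (a 0) (a 1) (a 2)) (binCubic r' s' t') (binProd (a i) (a j)) = 0 := by
  fin_cases i <;> fin_cases j <;> first | exact absurd rfl hij | skip
  all_goals simp [bezoutian, binCubic, binProd]; ring

theorem binProd_add (r s t : ℂ × ℂ) : binProd r (s + t) = binProd r s + binProd r t := by
  ext i
  fin_cases i <;> simp [binProd] <;> ring

theorem QuadraticMap.map_smul_add_smul {R M : Type*} [CommRing R] [AddCommGroup M] [Module R M]
    (Q : QuadraticMap R M R) (c d : R) (u v : M) :
    Q (c • u + d • v) = c ^ 2 * Q u + d ^ 2 * Q v + c * d * QuadraticMap.polar Q u v := by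
  rw [QuadraticMap.map_add Q, QuadraticMap.map_smul, QuadraticMap.map_smul,
    QuadraticMap.polar_smul_left, QuadraticMap.polar_smul_right]
  simp only [smul_eq_mul]
  ring

/-- A quadratic form vanishes if it vanishes on the kernel of a linear form `φ` and at three
spanning vectors off that kernel. -/
theorem QuadraticMap.eq_zero_of_ker_of_span {K V : Type*} [Field K] [AddCommGroup V] [Module K V]
    (Q : QuadraticMap K V K) (φ : V →ₗ[K] K) (hker : ∀ y, φ y = 0 → Q y = 0) {u v w : V}
    (hspan : ∀ y, ∃ c d e : K, y = c • u + d • v + e • w)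
    (hφu : φ u ≠ 0) (hφv : φ v ≠ 0) (hφw : φ w ≠ 0)
    (hu : Q u = 0) (hv : Q v = 0) (hw : Q w = 0) : Q = 0 := by
  have hpolar : ∀ x z : V, φ x ≠ 0 → φ z ≠ 0 → Q x = 0 → Q z = 0 →
      QuadraticMap.polar Q x z = 0 := by
    intro x z hφx hφz hx hz
    have h := hker (φ z • x + (-φ x) • z) (by simp; ring)
    rw [Q.map_smul_add_smul, hx, hz] at h
    simpa [hφx, hφz] using h
  ext y
  obtain ⟨c, d, e, rfl⟩ := hspan y
  have h := Q.map_smul_add_smul 1 e (c • u + d • v) w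
  rw [one_smul] at h
  rw [h, Q.map_smul_add_smul, hu, hv, hw, QuadraticMap.polar_add_left,
    QuadraticMap.polar_smul_left, QuadraticMap.polar_smul_left, hpolar u v hφu hφv hu hv,
    hpolar u w hφu hφw hu hw, hpolar v w hφv hφw hv hw]
  simp

/-- A conic through the pairwise products of two disjoint triples of roots is, up to a scalar,
given by the Bezoutian of the corresponding binary cubics. -/
theorem exists_eq_smul_bezoutian {a b : Fin 3 → ℂ × ℂ}
    (ha : ∀ i j, i ≠ j → bracket (a i) (a j) ≠ 0) (hb : ∀ i j, i ≠ j → bracket (b i) (b j) ≠ 0)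
    (hab : ∀ i j, bracket (a i) (b j) ≠ 0) (Q : QuadraticForm ℂ (Fin 3 → ℂ))
    (hQa : ∀ i j, i ≠ j → Q (binProd (a i) (a j)) = 0)
    (hQb : ∀ i j, i ≠ j → Q (binProd (b i) (b j)) = 0) :
    ∃ c : ℂ, Q = c • bezoutian (binCubic (a 0) (a 1) (a 2)) (binCubic (b 0) (b 1) (b 2)) := by
  set B := bezoutian (binCubic (a 0) (a 1) (a 2)) (binCubic (b 0) (b 1) (b 2)) with hB
  have hBa : ∀ i j, i ≠ j → B (binProd (a i) (a j)) = 0 := fun i j hij =>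
    bezoutian_binCubic_binProd_eq_zero a _ _ _ hij
  have hBb : ∀ i j, i ≠ j → B (binProd (b i) (b j)) = 0 := fun i j hij => by
    rw [hB, bezoutian_swap, bezoutian_binCubic_binProd_eq_zero b _ _ _ hij, neg_zero]
  have h01 : (0 : Fin 3) ≠ 1 := by decide
  have h02 : (0 : Fin 3) ≠ 2 := by decide
  have h12 : (1 : Fin 3) ≠ 2 := by decide
  set u := binProd (a 0) (a 1) with hu
  set v := binProd (a 0) (a 2) with hv
  have hpol : QuadraticMap.polar B u v ≠ 0 := by
    rw [QuadraticMap.polar, hBa 0 1 h01, hBa 0 2 h02, hu, hv, ← binProd_add, hB,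
      bezoutian_binCubic_binProd, sub_zero, sub_zero]
    have h₁ : bracket (a 1 + a 2) (a 1) = -bracket (a 1) (a 2) := by
      simp only [bracket, Prod.fst_add, Prod.snd_add]
      ring
    have h₂ : bracket (a 1 + a 2) (a 2) = bracket (a 1) (a 2) := by
      simp only [bracket, Prod.fst_add, Prod.snd_add]
      ring
    rw [h₁, h₂]
    simp [hab, ha 1 2 h12]
  refine ⟨QuadraticMap.polar Q u v / QuadraticMap.polar B u v, ?_⟩
  rw [← sub_eq_zero]
  set c := QuadraticMap.polar Q u v / QuadraticMap.polar B u v with hc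
  have hker : ∀ y, binEval (a 0) y = 0 → (Q - c • B) y = 0 := by
    intro y hy
    rw [exists_eq_binProd_combination (ha 0 1 h01) (ha 0 2 h02) (ha 1 2 h12) y, hy, zero_div,
      zero_smul, add_zero, sub_apply, smul_apply,
      QuadraticMap.map_smul_add_smul, QuadraticMap.map_smul_add_smul, hQa 0 1 h01, hQa 0 2 h02,
      hBa 0 1 h01, hBa 0 2 h02, hc, smul_eq_mul]
    field_simp
    ring
  refine QuadraticMap.eq_zero_of_ker_of_span _ (binEval (a 0)) hker (fun y => ⟨_, _, _,
    exists_eq_binProd_combination (hb 0 1 h01) (hb 0 2 h02) (hb 1 2 h12) y⟩) ?_ ?_ ?_ ?_ ?_ ?_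
  iterate 3
    rw [binEval_binProd]
    exact mul_ne_zero (hab _ _) (hab _ _)
  · simp [hQb 0 1 h01, hBb 0 1 h01]
  · simp [hQb 0 2 h02, hBb 0 2 h02]
  · simp [hQb 1 2 h12, hBb 1 2 h12]

/-- The Bezoutian of two binary cubics annihilated by a functional `φ` vanishes at every quadratic
form whose multiples are annihilated by `φ`. -/
theorem bezoutian_eq_zero_of_mulVec {f g φ : Fin 4 → ℂ} {u : Fin 3 → ℂ} (hφ : φ ≠ 0)
    (hf : ∑ i, f i * φ i = 0) (hg : ∑ i, g i * φ i = 0)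
    (h₀ : u 0 * φ 0 + u 1 * φ 1 + u 2 * φ 2 = 0) (h₁ : u 0 * φ 1 + u 1 * φ 2 + u 2 * φ 3 = 0) :
    bezoutian f g u = 0 := by
  rw [bezoutian_apply, ← Matrix.exists_mulVec_eq_zero_iff]
  refine ⟨φ, hφ, ?_⟩
  rw [Fin.sum_univ_four] at hf hg
  ext i
  fin_cases i <;> simp [bezoutMatrix, Matrix.mulVec, dotProduct, Fin.sum_univ_four] <;> assumption

theorem exists_ne_zero_mulVec_eq_zero {m n : ℕ} (hmn : m < n) (A : Matrix (Fin m) (Fin n) ℂ) :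
    ∃ v : Fin n → ℂ, v ≠ 0 ∧ A.mulVec v = 0 := by
  have h : LinearMap.ker A.mulVecLin ≠ ⊥ :=
    LinearMap.ker_ne_bot_of_finrank_lt (by simpa using hmn)
  obtain ⟨v, hv, hv0⟩ := (Submodule.ne_bot_iff _).mp h
  exact ⟨v, hv0, by simpa using hv⟩

/-- The three Bezoutians of three binary cubic forms have a common zero. -/
theorem exists_common_zero_bezoutian (f g h : Fin 4 → ℂ) :
    ∃ u : Fin 3 → ℂ, u ≠ 0 ∧ bezoutian f g u = 0 ∧ bezoutian f h u = 0 ∧ bezoutian g h u = 0 := by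
  obtain ⟨φ, hφ, hA⟩ := exists_ne_zero_mulVec_eq_zero (by norm_num) (Matrix.of ![f, g, h])
  obtain ⟨u, hu, hU⟩ := exists_ne_zero_mulVec_eq_zero (by norm_num)
    !![φ 0, φ 1, φ 2; φ 1, φ 2, φ 3]
  have hf : ∑ i, f i * φ i = 0 := congrFun hA 0
  have hg : ∑ i, g i * φ i = 0 := congrFun hA 1
  have hh : ∑ i, h i * φ i = 0 := congrFun hA 2
  have h₀ : u 0 * φ 0 + u 1 * φ 1 + u 2 * φ 2 = 0 := by
    simpa [Matrix.mulVec, dotProduct, Fin.sum_univ_three, mul_comm] using congrFun hU 0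
  have h₁ : u 0 * φ 1 + u 1 * φ 2 + u 2 * φ 3 = 0 := by
    simpa [Matrix.mulVec, dotProduct, Fin.sum_univ_three, mul_comm] using congrFun hU 1
  exact ⟨u, hu, bezoutian_eq_zero_of_mulVec hφ hf hg h₀ h₁,
    bezoutian_eq_zero_of_mulVec hφ hf hh h₀ h₁, bezoutian_eq_zero_of_mulVec hφ hg hh h₀ h₁⟩

/-- A binary quadratic form which is not the square of a linear form has two distinct roots. -/
theorem exists_square_of_roots_unique {b : Fin 3 → ℂ}
    (huniq : ∀ s t : ℂ × ℂ, s ≠ 0 → t ≠ 0 →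
      b 0 * s.1 ^ 2 + b 1 * (2 * s.1 * s.2) + b 2 * s.2 ^ 2 = 0 →
      b 0 * t.1 ^ 2 + b 1 * (2 * t.1 * t.2) + b 2 * t.2 ^ 2 = 0 → bracket s t = 0) :
    ∃ t : ℂ × ℂ, b 0 = t.1 ^ 2 ∧ b 1 = t.1 * t.2 ∧ b 2 = t.2 ^ 2 := by
  have hdisc : b 1 ^ 2 = b 0 * b 2 := by
    by_cases h0 : b 0 = 0
    · by_cases h1 : b 1 = 0
      · simp [h0, h1]
      · have h := huniq (1, 0) (-b 2, 2 * b 1) (by simp) (by simp [h1]) (by simp [h0])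
          (by simp only [h0]; ring)
        simp [bracket, h1] at h
    · obtain ⟨δ, hδ⟩ := IsAlgClosed.exists_pow_nat_eq (b 1 ^ 2 - b 0 * b 2) two_pos
      have h := huniq (-b 1 + δ, b 0) (-b 1 - δ, b 0) (by simp [h0]) (by simp [h0])
        (by linear_combination b 0 * hδ) (by linear_combination b 0 * hδ)
      have hδ0 : δ = 0 := by
        have h' : b 0 * δ = 0 := by
          simp only [bracket] at h
          linear_combination h / 2
        exact (mul_eq_zero.mp h').resolve_left h0
      rw [hδ0] at hδ
      linear_combination -hδ
  obtain ⟨c, hc⟩ := IsAlgClosed.exists_pow_nat_eq (b 0) two_pos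
  obtain ⟨d, hd⟩ := IsAlgClosed.exists_pow_nat_eq (b 2) two_pos
  have h : b 1 ^ 2 = (c * d) ^ 2 := by rw [hdisc, ← hc, ← hd]; ring
  rcases sq_eq_sq_iff_eq_or_eq_neg.mp h with h | h
  · exact ⟨(c, d), hc.symm, h, hd.symm⟩
  · exact ⟨(c, -d), hc.symm, by simp [h], by simp [hd]⟩

/-- In coordinates where the conic is the discriminant, a tangent line consists of the binary
quadratic forms with a given root. -/
theorem exists_eq_setOf_binEval_eq_zero {q : MvPolynomial (Fin 3) ℂ} (hq : q.IsHomogeneous 2)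
    (N : (Fin 3 → ℂ) ≃ₗ[ℂ] (Fin 3 → ℂ))
    (hN : ∀ x, eval x q = N x 1 ^ 2 - 4 * (N x 0 * N x 2)) {L : Set P2} (hL : IsLine L)
    (ht : IsTangent L {p : P2 | eval p.rep q = 0}) :
    ∃ t : ℂ × ℂ, t ≠ 0 ∧ L = {p : P2 | binEval t (N p.rep) = 0} := by
  obtain ⟨a, ha, rfl⟩ := hL
  obtain ⟨p, hp⟩ := ht
  let φ : (Fin 3 → ℂ) →ₗ[ℂ] ℂ := ∑ i, a i • LinearMap.proj i
  have hφ : ∀ x, φ x = ∑ i, a i * x i := fun x => by simp [φ]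
  let b : Fin 3 → ℂ := fun k => φ (N.symm (Pi.single k 1))
  have hb : ∀ x, φ x = b 0 * N x 0 + b 1 * N x 1 + b 2 * N x 2 := by
    intro x
    have h := (φ ∘ₗ N.symm.toLinearMap).apply_eq_sum_mul_single (N x)
    simp only [LinearMap.comp_apply, LinearEquiv.coe_coe, N.symm_apply_apply,
      Fin.sum_univ_three] at h
    rw [h]
    ring
  have hmem : ∀ s : ℂ × ℂ, s ≠ 0 → b 0 * s.1 ^ 2 + b 1 * (2 * s.1 * s.2) + b 2 * s.2 ^ 2 = 0 →
      ∃ h : N.symm ![s.1 ^ 2, 2 * s.1 * s.2, s.2 ^ 2] ≠ 0, Projectivization.mk ℂ _ h = p := by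
    intro s hs hs0
    have hne : N.symm ![s.1 ^ 2, 2 * s.1 * s.2, s.2 ^ 2] ≠ 0 := by
      rw [Ne, LinearEquiv.map_eq_zero_iff]
      intro h
      have e0 := congrFun h 0
      have e2 := congrFun h 2
      simp at e0 e2
      exact hs (Prod.ext e0 e2)
    refine ⟨hne, ?_⟩
    rw [← Set.mem_singleton_iff, ← hp]
    constructor
    · rw [Set.mem_ofPred_eq, ← hφ, linear_rep_mk_eq_zero_iff, hb]
      simpa using hs0
    · rw [Set.mem_ofPred_eq, eval_rep_mk_eq_zero_iff hq, hN]
      simp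
      ring
  obtain ⟨t, h0, h1, h2⟩ := exists_square_of_roots_unique (b := b) (by
    intro s t hs ht hs0 ht0
    obtain ⟨hs', hsp⟩ := hmem s hs hs0
    obtain ⟨ht', htp⟩ := hmem t ht ht0
    obtain ⟨k, hk⟩ := (Projectivization.mk_eq_mk_iff' ℂ _ _ hs' ht').mp (hsp.trans htp.symm)
    rw [← map_smul, N.symm.injective.eq_iff] at hk
    have e0 := congrFun hk 0
    have e1 := congrFun hk 1
    have e2 := congrFun hk 2
    simp at e0 e1 e2
    have : bracket s t ^ 2 = 0 := by
      simp only [bracket]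
      linear_combination (-t.2 ^ 2) * e0 + t.1 * t.2 * e1 - t.1 ^ 2 * e2
    simpa using this)
  have hbin : ∀ x, φ x = binEval t (N x) := fun x => by
    rw [hb, binEval_apply, h0, h1, h2]
  refine ⟨t, ?_, ?_⟩
  · rintro rfl
    apply ha
    ext i
    have := hbin (Pi.single i 1)
    rw [hφ, binEval_apply] at this
    simpa [Pi.single_apply] using this
  · ext p
    rw [Set.mem_ofPred_eq, Set.mem_ofPred_eq, ← hφ, hbin]

theorem setOf_binEval_eq_of_bracket_eq_zero (N : (Fin 3 → ℂ) ≃ₗ[ℂ] (Fin 3 → ℂ)) {s t : ℂ × ℂ}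
    (hs : s ≠ 0) (ht : t ≠ 0) (hst : bracket s t = 0) :
    {p : P2 | binEval s (N p.rep) = 0} = {p : P2 | binEval t (N p.rep) = 0} := by
  have key : ∀ s t : ℂ × ℂ, s ≠ 0 → bracket s t = 0 → ∀ y, binEval s y = 0 →
      binEval t y = 0 := by
    intro s t hs hst y hy
    rw [binEval_apply] at hy ⊢
    simp only [bracket] at hst
    by_cases h1 : s.1 = 0
    · have h2 : s.2 ≠ 0 := fun h2 => hs (Prod.ext h1 h2)
      have : s.2 ^ 2 * (t.1 ^ 2 * y 0 + t.1 * t.2 * y 1 + t.2 ^ 2 * y 2) = 0 := by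
        linear_combination t.2 ^ 2 * hy - ((s.2 * t.1 + s.1 * t.2) * y 0 + s.2 * t.2 * y 1) * hst
      simpa [h2] using this
    · have : s.1 ^ 2 * (t.1 ^ 2 * y 0 + t.1 * t.2 * y 1 + t.2 ^ 2 * y 2) = 0 := by
        linear_combination t.1 ^ 2 * hy + ((s.2 * t.1 + s.1 * t.2) * y 2 + s.1 * t.1 * y 1) * hst
      simpa [h1] using this
  ext p
  exact ⟨key s t hs hst _, key t s ht (by rw [bracket_swap, hst, neg_zero]) _⟩

/-- A conic through the star configurations of two triples of tangent lines is given by a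
Bezoutian. -/
theorem exists_eval_eq_mul_bezoutian (N : (Fin 3 → ℂ) ≃ₗ[ℂ] (Fin 3 → ℂ)) {L M : Fin 3 → Set P2}
    {a b : Fin 3 → ℂ × ℂ} (hL : ∀ i, L i = {p : P2 | binEval (a i) (N p.rep) = 0})
    (hM : ∀ i, M i = {p : P2 | binEval (b i) (N p.rep) = 0})
    (ha0 : ∀ i, a i ≠ 0) (hb0 : ∀ i, b i ≠ 0)
    (hLinj : Function.Injective L) (hMinj : Function.Injective M) (hLM : ∀ i j, L i ≠ M j)
    {q : MvPolynomial (Fin 3) ℂ} (hq : q.IsHomogeneous 2)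
    (hv : ∀ p ∈ starConfig L ∪ starConfig M, eval p.rep q = 0) :
    ∃ c : ℂ, ∀ y, eval (N.symm y) q =
      c * bezoutian (binCubic (a 0) (a 1) (a 2)) (binCubic (b 0) (b 1) (b 2)) y := by
  obtain ⟨Q, hQ⟩ := exists_quadraticForm_of_isHomogeneous hq
  have hbr : ∀ {L M : Fin 3 → Set P2} {a b : Fin 3 → ℂ × ℂ},
      (∀ i, L i = {p : P2 | binEval (a i) (N p.rep) = 0}) →
      (∀ i, M i = {p : P2 | binEval (b i) (N p.rep) = 0}) →
      (∀ i, a i ≠ 0) → (∀ i, b i ≠ 0) → ∀ i j, L i ≠ M j → bracket (a i) (b j) ≠ 0 := by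
    intro L M a b hL hM ha0 hb0 i j hij h
    rw [hL, hM] at hij
    exact hij (setOf_binEval_eq_of_bracket_eq_zero N (ha0 i) (hb0 j) h)
  have ha : ∀ i j, i ≠ j → bracket (a i) (a j) ≠ 0 := fun i j hij =>
    hbr hL hL ha0 ha0 i j (hLinj.ne hij)
  have hb : ∀ i j, i ≠ j → bracket (b i) (b j) ≠ 0 := fun i j hij =>
    hbr hM hM hb0 hb0 i j (hMinj.ne hij)
  have hab : ∀ i j, bracket (a i) (b j) ≠ 0 := fun i j => hbr hL hM ha0 hb0 i j (hLM i j)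
  have hvan : ∀ {L : Fin 3 → Set P2} {a b : Fin 3 → ℂ × ℂ},
      (∀ i, L i = {p : P2 | binEval (a i) (N p.rep) = 0}) →
      (∀ i j, bracket (b j) (a i) ≠ 0) → (∀ p ∈ starConfig L, eval p.rep q = 0) →
      ∀ i j, i ≠ j → (Q.comp N.symm.toLinearMap) (binProd (a i) (a j)) = 0 := by
    intro L a b hL hab hv i j hij
    have hne : N.symm (binProd (a i) (a j)) ≠ 0 := by
      rw [Ne, LinearEquiv.map_eq_zero_iff]
      intro h
      have h' := binEval_binProd (b 0) (a i) (a j)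
      rw [h, map_zero] at h'
      exact mul_ne_zero (hab i 0) (hab j 0) h'.symm
    have h := hv (Projectivization.mk ℂ _ hne) ⟨i, j, hij, by
      rw [hL, Set.mem_ofPred_eq]
      refine (linear_rep_mk_eq_zero_iff (binEval (a i) ∘ₗ N.toLinearMap) hne).mpr ?_
      simp [binEval_binProd, bracket_self], by
      rw [hL, Set.mem_ofPred_eq]
      refine (linear_rep_mk_eq_zero_iff (binEval (a j) ∘ₗ N.toLinearMap) hne).mpr ?_
      simp [binEval_binProd, bracket_self]⟩
    rw [eval_rep_mk_eq_zero_iff hq, hQ] at h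
    simpa using h
  obtain ⟨c, hc⟩ := exists_eq_smul_bezoutian ha hb hab (Q.comp N.symm.toLinearMap)
    (hvan hL (fun i j => by rw [bracket_swap, neg_ne_zero]; exact hab i j)
      fun p hp => hv p (Or.inl hp))
    (hvan hM (fun i j => hab j i) fun p hp => hv p (Or.inr hp))
  refine ⟨c, fun y => ?_⟩
  have := congrArg (fun F : QuadraticForm ℂ (Fin 3 → ℂ) => F y) hc
  simpa [hQ] using this

/-- **Three conics through pairs of contact star configurations meet in a point.**
Let `γ` be an irreducible conic and `ℓ₁,ℓ₂,ℓ₃, m₁,m₂,m₃, n₁,n₂,n₃` nine pairwise distinct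
lines tangent to `γ`, defining contact star configurations `X₁, X₂, X₃`.  For each pair
`i < j` let `q_{ij}` be a nonzero quadratic form vanishing on `X_i ∪ X_j`.  Then the three
conics `γ₁₂, γ₁₃, γ₂₃` meet in a common point. -/
theorem three_conics_meet_in_a_point
    (γ : Set P2) (hγ : IsIrredConic γ)
    (ℓ m nn : Fin 3 → Set P2)
    (hℓline : ∀ i, IsLine (ℓ i)) (hmline : ∀ j, IsLine (m j)) (hnline : ∀ k, IsLine (nn k))
    (hℓtan : ∀ i, IsTangent (ℓ i) γ) (hmtan : ∀ j, IsTangent (m j) γ)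
    (hntan : ∀ k, IsTangent (nn k) γ)
    (hℓinj : Function.Injective ℓ) (hminj : Function.Injective m)
    (hninj : Function.Injective nn)
    (hℓm : ∀ i j, ℓ i ≠ m j) (hℓn : ∀ i k, ℓ i ≠ nn k) (hmn : ∀ j k, m j ≠ nn k)
    (q₁₂ q₁₃ q₂₃ : MvPolynomial (Fin 3) ℂ)
    (hq₁₂0 : q₁₂ ≠ 0) (hq₁₂2 : q₁₂.IsHomogeneous 2)
    (hq₁₂v : ∀ p ∈ starConfig ℓ ∪ starConfig m, eval p.rep q₁₂ = 0)
    (hq₁₃0 : q₁₃ ≠ 0) (hq₁₃2 : q₁₃.IsHomogeneous 2)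
    (hq₁₃v : ∀ p ∈ starConfig ℓ ∪ starConfig nn, eval p.rep q₁₃ = 0)
    (hq₂₃0 : q₂₃ ≠ 0) (hq₂₃2 : q₂₃.IsHomogeneous 2)
    (hq₂₃v : ∀ p ∈ starConfig m ∪ starConfig nn, eval p.rep q₂₃ = 0) :
    ∃ p : P2, eval p.rep q₁₂ = 0 ∧ eval p.rep q₁₃ = 0 ∧ eval p.rep q₂₃ = 0 := by
  obtain ⟨q, hq, hirr, rfl⟩ := hγ
  obtain ⟨N, hN⟩ := exists_equiv_eval_eq_discrim hq hirr
  choose a ha0 ha using fun i => exists_eq_setOf_binEval_eq_zero hq N hN (hℓline i) (hℓtan i)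
  choose b hb0 hb using fun i => exists_eq_setOf_binEval_eq_zero hq N hN (hmline i) (hmtan i)
  choose c hc0 hc using fun i => exists_eq_setOf_binEval_eq_zero hq N hN (hnline i) (hntan i)
  obtain ⟨c₁₂, h₁₂⟩ :=
    exists_eval_eq_mul_bezoutian N ha hb ha0 hb0 hℓinj hminj hℓm hq₁₂2 hq₁₂v
  obtain ⟨c₁₃, h₁₃⟩ :=
    exists_eval_eq_mul_bezoutian N ha hc ha0 hc0 hℓinj hninj hℓn hq₁₃2 hq₁₃v
  obtain ⟨c₂₃, h₂₃⟩ :=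
    exists_eval_eq_mul_bezoutian N hb hc hb0 hc0 hminj hninj hmn hq₂₃2 hq₂₃v
  obtain ⟨u, hu, z₁₂, z₁₃, z₂₃⟩ := exists_common_zero_bezoutian (binCubic (a 0) (a 1) (a 2))
    (binCubic (b 0) (b 1) (b 2)) (binCubic (c 0) (c 1) (c 2))
  have hne : N.symm u ≠ 0 := N.symm.map_ne_zero_iff.mpr hu
  refine ⟨Projectivization.mk ℂ _ hne, ?_, ?_, ?_⟩
  · rw [eval_rep_mk_eq_zero_iff hq₁₂2, h₁₂, z₁₂, mul_zero]
  · rw [eval_rep_mk_eq_zero_iff hq₁₃2, h₁₃, z₁₃, mul_zero]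
  · rw [eval_rep_mk_eq_zero_iff hq₂₃2, h₂₃, z₂₃, mul_zero]
end
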